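/- For every simple digraph G, there is an isomorphism of chain complexes Π_*(G) ≅ Π_*(Ḡ), where Ḡ is the inverse directed digraph obtained by reversing all arrows. Consequently the primitive path homology groups satisfy H_n(G) ≅ H_n(Ḡ) for all n ≥ 0. The isomorphism sends e_{i_0…i_n} to ± e_{i_n…i_0}, with sign + if n ≡ 0, 3 (mod 4) and − if n ≡ 1, 2 (mod 4). -/

import Mathlib

noncomputable section

namespace PrimitivePath

/-- A simple digraph: arrows between distinct vertices. -/
structure SDigraph (V : Type) where
  Adj : V → V → Prop
  loopless : ∀ v, ¬ Adj v v

section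

variable (R V : Type) [CommRing R] [DecidableEq V]

/-- `Chain R V n` is the free `R`-module `Λ_n(V,R)` on elementary `n`-paths
(sequences of `n+1` vertices). -/
abbrev Chain (n : ℕ) : Type _ := (Fin (n + 1) → V) →₀ R

/-- An elementary path is allowed if consecutive vertices are joined by arrows. -/
def IsAllowed {V : Type} (G : SDigraph V) {n : ℕ} (p : Fin (n + 1) → V) : Prop :=
  ∀ i : Fin n, G.Adj (p i.castSucc) (p i.succ)

/-- An elementary path is regular if it has no two equal consecutive vertices. -/
def IsRegular {V : Type} {n : ℕ} (p : Fin (n + 1) → V) : Prop :=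
  ∀ i : Fin n, p i.castSucc ≠ p i.succ

instance {n : ℕ} (p : Fin (n + 1) → V) : Decidable (IsRegular p) :=
  inferInstanceAs (Decidable (∀ i : Fin n, p i.castSucc ≠ p i.succ))

/-- The differential `∂ : Λ_{n+1} → Λ_n`, alternating sum of vertex deletions. -/
def boundary (n : ℕ) : Chain R V (n + 1) →ₗ[R] Chain R V n :=
  Finsupp.lsum R fun p => ∑ m : Fin (n + 2),
    ((-1 : R) ^ (m : ℕ)) • Finsupp.lsingle (fun i : Fin (n + 1) => p (m.succAbove i))

/-- The `m`-th face map `∂^m : Λ_{n+1} → Λ_n`, deleting the `m`-th vertex. -/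
def faceMap (n : ℕ) (m : Fin (n + 2)) : Chain R V (n + 1) →ₗ[R] Chain R V n :=
  Finsupp.lsum R fun p => Finsupp.lsingle (fun i : Fin (n + 1) => p (m.succAbove i))

/-- The submodule of chains all of whose elementary paths satisfy `P`. -/
def pathsWith {n : ℕ} (P : (Fin (n + 1) → V) → Prop) : Submodule R (Chain R V n) where
  carrier := {w | ∀ p ∈ w.support, P p}
  add_mem' := by
    intro x y hx hy p hp
    rcases Finset.mem_union.1 (Finsupp.support_add hp) with h | h
    · exact hx p h
    · exact hy p h
  zero_mem' := by intro p hp; simp at hp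
  smul_mem' := by intro c x hx p hp; exact hx p (Finsupp.support_smul hp)

/-- `A_n(G)`: the submodule of allowed chains. -/
def allowedChains (G : SDigraph V) (n : ℕ) : Submodule R (Chain R V n) :=
  pathsWith R V (fun p => IsAllowed G p)

/-- Chains all of whose elementary paths have tail vertex `a`. -/
def tailSet (a : V) (n : ℕ) : Submodule R (Chain R V n) :=
  pathsWith R V (fun p => p 0 = a)

/-- Chains all of whose elementary paths have head vertex `b`. -/
def headSet (b : V) (n : ℕ) : Submodule R (Chain R V n) :=
  pathsWith R V (fun p => p (Fin.last n) = b)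

/-- Chains all of whose elementary paths have tail `a` and head `b`
(the `(a,b)`-cluster module `Λ_n^{[a,b]}`). -/
def clusterSet (a b : V) (n : ℕ) : Submodule R (Chain R V n) :=
  pathsWith R V (fun p => p 0 = a ∧ p (Fin.last n) = b)

/-- Projection killing the irregular elementary paths, modelling `Λ_n → R_n = Λ_n/I_n`. -/
def regProj (n : ℕ) : Chain R V n →ₗ[R] Chain R V n :=
  Finsupp.lsum R fun p => if IsRegular p then Finsupp.lsingle p else 0

/-- The `(a,b)`-cluster component `w ↦ w^{[a,b]}`. -/
def clusterComp (a b : V) (n : ℕ) : Chain R V n →ₗ[R] Chain R V n :=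
  Finsupp.lsum R fun p =>
    if p 0 = a ∧ p (Fin.last n) = b then Finsupp.lsingle p else 0

/-- The `a`-tail component `w ↦ w^{[a,·]}`. -/
def tailComp (a : V) (n : ℕ) : Chain R V n →ₗ[R] Chain R V n :=
  Finsupp.lsum R fun p => if p 0 = a then Finsupp.lsingle p else 0

/-- The `b`-head component `w ↦ w^{[·,b]}`. -/
def headComp (b : V) (n : ℕ) : Chain R V n →ₗ[R] Chain R V n :=
  Finsupp.lsum R fun p => if p (Fin.last n) = b then Finsupp.lsingle p else 0

/-- `Π_n(G)`: the primitive path chain modules. -/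
def piChains (G : SDigraph V) : (n : ℕ) → Submodule R (Chain R V n)
  | 0 => allowedChains R V G 0
  | n + 1 =>
      allowedChains R V G (n + 1) ⊓ (allowedChains R V G n).comap (boundary R V n)

/-- `Ω_n(G)`: the path chain modules (differential taken modulo irregular paths). -/
def omegaChains (G : SDigraph V) : (n : ℕ) → Submodule R (Chain R V n)
  | 0 => allowedChains R V G 0
  | n + 1 =>
      allowedChains R V G (n + 1) ⊓
        (allowedChains R V G n).comap ((regProj R V n).comp (boundary R V n))

/-- Cycles of the primitive path chain complex. -/
def piCycles (G : SDigraph V) : (n : ℕ) → Submodule R (Chain R V n)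
  | 0 => piChains R V G 0
  | n + 1 => piChains R V G (n + 1) ⊓ LinearMap.ker (boundary R V n)

/-- Boundaries of the primitive path chain complex. -/
def piBoundaries (G : SDigraph V) (n : ℕ) : Submodule R (Chain R V n) :=
  (piChains R V G (n + 1)).map (boundary R V n)

/-- Primitive path homology `H_n(Π_*(G))`: the image of the cycles in the
quotient by the boundaries. -/
abbrev piHomology (G : SDigraph V) (n : ℕ) : Type _ :=
  ↥((piCycles R V G n).map (piBoundaries R V G n).mkQ)

/-- Cycles of the path chain complex `Ω_*`. -/
def omegaCycles (G : SDigraph V) : (n : ℕ) → Submodule R (Chain R V n)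
  | 0 => omegaChains R V G 0
  | n + 1 => omegaChains R V G (n + 1) ⊓ LinearMap.ker ((regProj R V n).comp (boundary R V n))

/-- Boundaries of the path chain complex `Ω_*`. -/
def omegaBoundaries (G : SDigraph V) (n : ℕ) : Submodule R (Chain R V n) :=
  (omegaChains R V G (n + 1)).map ((regProj R V n).comp (boundary R V n))

/-- Path homology `H_n(Ω_*(G))`. -/
abbrev omegaHomology (G : SDigraph V) (n : ℕ) : Type _ :=
  ↥((omegaCycles R V G n).map (omegaBoundaries R V G n).mkQ)

/-- The cluster differential `d : Λ_{n+2}^{[a,b]} → Λ_{n+1}^{[a,b]}`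
(alternating deletion of interior vertices only). -/
def clusterBoundary (n : ℕ) : Chain R V (n + 2) →ₗ[R] Chain R V (n + 1) :=
  Finsupp.lsum R fun p => ∑ m : Fin (n + 1),
    ((-1 : R) ^ (m : ℕ)) •
      Finsupp.lsingle (fun i : Fin (n + 2) => p (m.succ.castSucc.succAbove i))

/-- `π^{[a,b]}` in degrees `≥ 2`: delete the two end vertices. -/
def stripEnds (n : ℕ) : Chain R V (n + 2) →ₗ[R] Chain R V n :=
  Finsupp.lsum R fun p => Finsupp.lsingle (fun i : Fin (n + 1) => p i.succ.castSucc)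

/-- The sum-of-coefficients map (augmentation when `n = 0`). -/
def totalCoeff (n : ℕ) : Chain R V n →ₗ[R] R :=
  Finsupp.lsum R fun _ => LinearMap.id

/-- `A_n^{[a,b]}(G)`: allowed `(a,b)`-cluster chains. -/
def allowedCluster (G : SDigraph V) (a b : V) (n : ℕ) : Submodule R (Chain R V n) :=
  allowedChains R V G n ⊓ clusterSet R V a b n

/-- `Θ_n^{[a,b]}(G)`. -/
def thetaChains (G : SDigraph V) (a b : V) : (n : ℕ) → Submodule R (Chain R V n)
  | 0 => ⊥
  | 1 => allowedCluster R V G a b 1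
  | n + 2 =>
      allowedCluster R V G a b (n + 2) ⊓
        (allowedCluster R V G a b (n + 1)).comap (clusterBoundary R V n)

def thetaCycles (G : SDigraph V) (a b : V) : (n : ℕ) → Submodule R (Chain R V n)
  | 0 => ⊥
  | 1 => thetaChains R V G a b 1
  | n + 2 => thetaChains R V G a b (n + 2) ⊓ LinearMap.ker (clusterBoundary R V n)

def thetaBoundaries (G : SDigraph V) (a b : V) : (n : ℕ) → Submodule R (Chain R V n)
  | 0 => ⊥
  | n + 1 => (thetaChains R V G a b (n + 2)).map (clusterBoundary R V n)

/-- Primitive `(a,b)`-cluster homology `H_n^{[a,b]}(G)`. -/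
abbrev thetaHomology (G : SDigraph V) (a b : V) (n : ℕ) : Type _ :=
  ↥((thetaCycles R V G a b n).map (thetaBoundaries R V G a b n).mkQ)

/-- The tail differential `d^t` (never deleting the tail vertex). -/
def tailBoundary (n : ℕ) : Chain R V (n + 1) →ₗ[R] Chain R V n :=
  Finsupp.lsum R fun p => ∑ m : Fin (n + 1),
    ((-1 : R) ^ (m : ℕ)) • Finsupp.lsingle (fun i : Fin (n + 1) => p (m.succ.succAbove i))

/-- The head differential `d^h` (never deleting the head vertex). -/
def headBoundary (n : ℕ) : Chain R V (n + 1) →ₗ[R] Chain R V n :=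
  Finsupp.lsum R fun p => ∑ m : Fin (n + 1),
    ((-1 : R) ^ (m : ℕ)) • Finsupp.lsingle (fun i : Fin (n + 1) => p (m.castSucc.succAbove i))

/-- `π^{[a,·]}` in degrees `≥ 1`: delete the first vertex. -/
def stripHead (n : ℕ) : Chain R V (n + 1) →ₗ[R] Chain R V n :=
  Finsupp.lsum R fun p => Finsupp.lsingle (fun i : Fin (n + 1) => p i.succ)

/-- `π^{[·,a]}` in degrees `≥ 1`: delete the last vertex. -/
def stripLast (n : ℕ) : Chain R V (n + 1) →ₗ[R] Chain R V n :=
  Finsupp.lsum R fun p => Finsupp.lsingle (fun i : Fin (n + 1) => p i.castSucc)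

/-- `A_n^{[a,·]}(G)`: allowed chains with tail `a`. -/
def allowedTail (G : SDigraph V) (a : V) (n : ℕ) : Submodule R (Chain R V n) :=
  allowedChains R V G n ⊓ tailSet R V a n

/-- `A_n^{[·,a]}(G)`: allowed chains with head `a`. -/
def allowedHead (G : SDigraph V) (a : V) (n : ℕ) : Submodule R (Chain R V n) :=
  allowedChains R V G n ⊓ headSet R V a n

/-- `Θ_n^{[a,·]}(G)`. -/
def tailTheta (G : SDigraph V) (a : V) : (n : ℕ) → Submodule R (Chain R V n)
  | 0 => allowedTail R V G a 0
  | n + 1 =>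
      allowedTail R V G a (n + 1) ⊓ (allowedTail R V G a n).comap (tailBoundary R V n)

/-- `Θ_n^{[·,a]}(G)`. -/
def headTheta (G : SDigraph V) (a : V) : (n : ℕ) → Submodule R (Chain R V n)
  | 0 => allowedHead R V G a 0
  | n + 1 =>
      allowedHead R V G a (n + 1) ⊓ (allowedHead R V G a n).comap (headBoundary R V n)

def tailCycles (G : SDigraph V) (a : V) : (n : ℕ) → Submodule R (Chain R V n)
  | 0 => tailTheta R V G a 0
  | n + 1 => tailTheta R V G a (n + 1) ⊓ LinearMap.ker (tailBoundary R V n)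

def tailBoundaries (G : SDigraph V) (a : V) (n : ℕ) : Submodule R (Chain R V n) :=
  (tailTheta R V G a (n + 1)).map (tailBoundary R V n)

/-- Primitive `a`-tail homology `H_n^{[a,·]}(G)`. -/
abbrev tailHomology (G : SDigraph V) (a : V) (n : ℕ) : Type _ :=
  ↥((tailCycles R V G a n).map (tailBoundaries R V G a n).mkQ)

/-- The path-reversal map with sign `(-1)^{n(n+1)/2}`. -/
def revMap (n : ℕ) : Chain R V n →ₗ[R] Chain R V n :=
  Finsupp.lsum R fun p =>
    ((-1 : R) ^ (n * (n + 1) / 2)) • Finsupp.lsingle (fun i : Fin (n + 1) => p i.rev)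

end

/-- The inverse directed digraph: all arrows reversed. -/
def SDigraph.reverse {V : Type} (G : SDigraph V) : SDigraph V where
  Adj v w := G.Adj w v
  loopless v h := G.loopless v h

section

variable (R : Type) [CommRing R] (V W : Type) [DecidableEq V] [DecidableEq W]

/-- The chain map `f_♯` induced by a vertex map: elementary paths go to their image
when regular, and to `0` otherwise. -/
def chainMap (f : V → W) (n : ℕ) : Chain R V n →ₗ[R] Chain R W n :=
  Finsupp.lsum R fun p =>
    if IsRegular (fun i => f (p i)) then Finsupp.lsingle (fun i => f (p i)) else 0

end

/-- A digraph is asymmetric if it has no symmetric pair of arrows. -/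
def SDigraph.Asymmetric {V : Type} (G : SDigraph V) : Prop :=
  ∀ v w, G.Adj v w → ¬ G.Adj w v


section ReverseLemmas

variable (R : Type) [CommRing R] (V : Type) [DecidableEq V]

lemma revMap_single (n : ℕ) (p : Fin (n + 1) → V) (c : R) :
    revMap R V n (Finsupp.single p c) =
      ((-1 : R) ^ (n * (n + 1) / 2)) • Finsupp.single (fun i => p i.rev) c := by
  simp [revMap]

lemma boundary_single (n : ℕ) (p : Fin (n + 2) → V) (c : R) :
    boundary R V n (Finsupp.single p c) =
      ∑ m : Fin (n + 2), ((-1 : R) ^ (m : ℕ)) •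
        Finsupp.single (fun i : Fin (n + 1) => p (m.succAbove i)) c := by
  simp [boundary, LinearMap.sum_apply]

lemma sign_sq (k : ℕ) : ((-1 : R) ^ k) * ((-1 : R) ^ k) = 1 := by
  rw [← mul_pow]; simp

lemma revMap_revMap (n : ℕ) (w : Chain R V n) : revMap R V n (revMap R V n w) = w := by
  induction w using Finsupp.induction_linear with
  | zero => simp
  | add f g hf hg => rw [map_add, map_add, hf, hg]
  | single p c =>
    rw [revMap_single, map_smul, revMap_single, smul_smul, sign_sq, one_smul]
    simp

/-- The reversal map as a linear equivalence. -/
def revEquiv (n : ℕ) : Chain R V n ≃ₗ[R] Chain R V n :=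
  LinearEquiv.ofInvolutive (revMap R V n) (revMap_revMap R V n)

lemma triangle_succ (n : ℕ) : (n + 1) * (n + 1 + 1) / 2 = n * (n + 1) / 2 + (n + 1) := by
  rw [show (n + 1) * (n + 1 + 1) = n * (n + 1) + (n + 1) * 2 by ring,
    Nat.add_mul_div_right _ _ (by norm_num)]

lemma revMap_boundary (n : ℕ) (w : Chain R V (n + 1)) :
    revMap R V n (boundary R V n w) = boundary R V n (revMap R V (n + 1) w) := by
  induction w using Finsupp.induction_linear with
  | zero => simp
  | add f g hf hg => rw [map_add, map_add, map_add, map_add, hf, hg]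
  | single p c =>
    rw [revMap_single, map_smul, boundary_single, boundary_single, map_sum, Finset.smul_sum]
    refine Fintype.sum_equiv Fin.revPerm _ _ fun m => ?_
    rw [map_smul, revMap_single, smul_smul, smul_smul]
    congr 1
    · rw [triangle_succ, Fin.revPerm_apply, Fin.val_rev, ← pow_add, ← pow_add]
      have hm := m.isLt
      have h : n * (n + 1) / 2 + (n + 1) + (n + 2 - (↑m + 1))
          + 2 * (m : ℕ) = (m : ℕ) + n * (n + 1) / 2 + 2 * (n + 1) := by omega
      have h2 := congrArg (fun k => (-1 : R) ^ k) h
      simpa [pow_add _ _ (2 * _), pow_mul] using h2.symm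
    · congr 1
      funext i
      simp [Fin.rev_succAbove]

lemma revMap_mem_allowed (G : SDigraph V) (n : ℕ) (w : Chain R V n)
    (hw : w ∈ allowedChains R V G n) : revMap R V n w ∈ allowedChains R V G.reverse n := by
  rw [← Finsupp.sum_single w, Finsupp.sum, map_sum]
  refine Submodule.sum_mem _ fun p hp => ?_
  rw [revMap_single]
  refine Submodule.smul_mem _ _ ?_
  intro q hq
  have hq' := Finset.mem_singleton.1 (Finsupp.support_single_subset hq)
  subst hq'
  intro i
  have h := hw p hp i.rev
  change G.Adj (p i.succ.rev) (p i.castSucc.rev)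
  rw [Fin.rev_succ, Fin.rev_castSucc]
  exact h

lemma revMap_mem_pi (G : SDigraph V) (n : ℕ) (w : Chain R V n)
    (hw : w ∈ piChains R V G n) : revMap R V n w ∈ piChains R V G.reverse n := by
  cases n with
  | zero => exact revMap_mem_allowed R V G 0 w hw
  | succ n =>
    refine ⟨revMap_mem_allowed R V G _ w hw.1, ?_⟩
    change boundary R V n _ ∈ allowedChains R V G.reverse n
    rw [← revMap_boundary]
    exact revMap_mem_allowed R V G _ _ hw.2

lemma revMap_mem_cycles (G : SDigraph V) (n : ℕ) (w : Chain R V n)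
    (hw : w ∈ piCycles R V G n) : revMap R V n w ∈ piCycles R V G.reverse n := by
  cases n with
  | zero => exact revMap_mem_pi R V G 0 w hw
  | succ n =>
    refine ⟨revMap_mem_pi R V G _ w hw.1, ?_⟩
    have h : boundary R V n w = 0 := hw.2
    change boundary R V n _ = 0
    rw [← revMap_boundary, h, map_zero]

lemma revMap_mem_boundaries (G : SDigraph V) (n : ℕ) (w : Chain R V n)
    (hw : w ∈ piBoundaries R V G n) : revMap R V n w ∈ piBoundaries R V G.reverse n := by
  obtain ⟨u, hu, rfl⟩ := hw
  exact ⟨revMap R V (n + 1) u, revMap_mem_pi R V G _ u hu, (revMap_boundary R V n u).symm⟩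

lemma map_rev_eq (n : ℕ) (P Q : Submodule R (Chain R V n))
    (h1 : ∀ w ∈ P, revMap R V n w ∈ Q) (h2 : ∀ w ∈ Q, revMap R V n w ∈ P) :
    P.map (revMap R V n) = Q := by
  apply le_antisymm
  · rintro _ ⟨w, hw, rfl⟩
    exact h1 w hw
  · intro w hw
    exact ⟨_, h2 w hw, revMap_revMap R V n w⟩

lemma homology_equiv (G : SDigraph V) (n : ℕ) :
    Nonempty (piHomology R V G n ≃ₗ[R] piHomology R V G.reverse n) := by
  have hC : (piCycles R V G n).map (revMap R V n) = piCycles R V G.reverse n :=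
    map_rev_eq R V n _ _ (revMap_mem_cycles R V G n) (revMap_mem_cycles R V G.reverse n)
  have hB : (piBoundaries R V G n).map (revMap R V n) = piBoundaries R V G.reverse n :=
    map_rev_eq R V n _ _ (revMap_mem_boundaries R V G n) (revMap_mem_boundaries R V G.reverse n)
  let e := Submodule.Quotient.equiv (piBoundaries R V G n) (piBoundaries R V G.reverse n)
    (revEquiv R V n) hB
  refine ⟨(e.submoduleMap _).trans (LinearEquiv.ofEq _ _ ?_)⟩
  rw [← hC, ← Submodule.map_comp]
  rw [← Submodule.map_comp]
  rfl

end ReverseLemmas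

/-- Theorem 3.11: the signed reversal map `e_{i_0…i_n} ↦ ± e_{i_n…i_0}`
(sign `+` iff `n ≡ 0, 3 (mod 4)`) is an isomorphism of chain complexes
`Π_*(G) ≅ Π_*(Ḡ)` and induces isomorphisms of primitive path homology groups. -/
theorem pi_iso_of_reverse
    (R : Type) [CommRing R] (V : Type) [DecidableEq V] [Fintype V]
    (G : SDigraph V) :
    (∀ (n : ℕ) (p : Fin (n + 1) → V),
      revMap R V n (Finsupp.single p 1) =
        ((-1 : R) ^ (n * (n + 1) / 2)) • Finsupp.single (fun i => p i.rev) 1) ∧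
    (∀ n : ℕ, Function.Bijective (revMap R V n)) ∧
    (∀ n : ℕ, (piChains R V G n).map (revMap R V n) = piChains R V G.reverse n) ∧
    (∀ (n : ℕ) (w : Chain R V (n + 1)),
      revMap R V n (boundary R V n w) = boundary R V n (revMap R V (n + 1) w)) ∧
    (∀ n : ℕ, Nonempty (piHomology R V G n ≃ₗ[R] piHomology R V G.reverse n)) := by
  exact ⟨fun n p => revMap_single R V n p 1, fun n => (revEquiv R V n).bijective,
    fun n => map_rev_eq R V n _ _ (revMap_mem_pi R V G n) (revMap_mem_pi R V G.reverse n),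
    revMap_boundary R V, homology_equiv R V G⟩

end PrimitivePath

end
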